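/- arXiv:2508.09899 — 4 statements merged into one kernel-verified Lean document; each statement's English description precedes it below -/
import Mathlib

section
/- For every integer g ≥ 1, the following identity of rational numbers holds: g·( Σ_{d=0}^{g-2} (2g)^{2d} / (2^{2d}·(2d+1)!) · Σ_{m=1}^{g-1-d} (-1)^m · C(2g-1+m, m) · Σ_{(i_1,…,i_m) ∈ ℤ_{>0}^m, i_1+⋯+i_m = g-1-d} ∏_{j=1}^m 1/(2^{2i_j}·(2i_j+1)!) ) + g·(2g)^{2g-2} / (2^{2g-2}·(2g-1)!) = 1. (This is the identity J_g = 1 established in Step 5 of the proof of the closed formula for Hodge integrals over meromorphic strata.) -/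
open PowerSeries in
/-- If `U² = U + cXU - XU'`, then `[X ^ n] U ^ (n + 1) = c ^ n`. -/
theorem PowerSeries.coeff_pow_succ_of_sq_eq {U : ℚ⟦X⟧} {c : ℚ} (h0 : constantCoeff U = 1)
    (hU : U ^ 2 = U + C c * X * U - X * derivative ℚ U) (n : ℕ) :
    coeff n (U ^ (n + 1)) = c ^ n := by
  induction n with
  | zero => simp [h0]
  | succ n ih =>
    have hd : derivative ℚ (U ^ (n + 1)) = C ((n : ℚ) + 1) * U ^ n * derivative ℚ U := by
      rw [Derivation.leibniz_pow]
      simp [smul_eq_mul, mul_assoc, nsmul_eq_mul]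
    have hrec : C ((n : ℚ) + 1) * U ^ (n + 2) = C ((n : ℚ) + 1) * U ^ (n + 1)
        + C (((n : ℚ) + 1) * c) * (X * U ^ (n + 1)) - X * derivative ℚ (U ^ (n + 1)) := by
      rw [hd, map_mul]
      linear_combination (C ((n : ℚ) + 1) * U ^ n) * hU
    have hc := congrArg (coeff (n + 1)) hrec
    rw [map_sub, (coeff (n + 1)).map_add, coeff_C_mul, coeff_C_mul, coeff_C_mul, coeff_succ_X_mul,
      coeff_succ_X_mul, coeff_derivative, ih] at hc
    have hn : (n : ℚ) + 1 ≠ 0 := by positivity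
    apply mul_left_cancel₀ hn
    rw [pow_succ c]
    linear_combination hc

open PowerSeries in
/-- The negative binomial expansion of a power of the inverse of `1 + H`. -/
theorem PowerSeries.coeff_pow_succ_of_mul_one_add_eq_one {R H : ℚ⟦X⟧} (hH : constantCoeff H = 0)
    (hR : R * (1 + H) = 1) (N k : ℕ) :
    coeff k (R ^ (N + 1)) =
      ∑ m ∈ Finset.range (k + 1), (-1) ^ m * ((N + m).choose m : ℚ) * coeff k (H ^ m) := by
  have hs : HasSubst (-H) := HasSubst.of_constantCoeff_zero' (by simp [hH])
  have h1 : subst (-H) (mk 1 : ℚ⟦X⟧) = R := by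
    have h := congrArg (substAlgHom (R := ℚ) hs) (mk_one_mul_one_sub_eq_one ℚ)
    rw [map_mul, map_sub, map_one, substAlgHom_X, coe_substAlgHom] at h
    linear_combination R * h - (subst (-H) (mk 1 : ℚ⟦X⟧)) * hR
  rw [← h1, ← subst_pow hs, mk_one_pow_eq_mk_choose_add, coeff_subst' hs,
    finsum_eq_sum_of_support_subset (s := Finset.range (k + 1))]
  · refine Finset.sum_congr rfl fun m _ => ?_
    rw [neg_pow, show ((-1 : ℚ⟦X⟧) ^ m) = C ((-1 : ℚ) ^ m) by simp, coeff_C_mul, coeff_mk,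
      Nat.choose_symm_add, smul_eq_mul]
    ring
  · intro m hm
    by_contra hmk
    apply hm
    have hlt : k < m := by simpa using hmk
    beta_reduce
    rw [coeff_of_lt_order (n := k) (φ := (-H) ^ m), smul_zero]
    refine lt_of_lt_of_le (by exact_mod_cast hlt) (le_order_pow_of_constantCoeff_eq_zero m ?_)
    simp [hH]

open PowerSeries in
theorem PowerSeries.coeff_pow_eq_sum_antidiagonalTuple (f : ℚ⟦X⟧) (m k : ℕ) :
    coeff k (f ^ m) = ∑ i ∈ Finset.Nat.antidiagonalTuple m k, ∏ j, coeff (i j) f := by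
  have h := coeff_prod (fun _ : Fin m => f) k Finset.univ
  rw [Finset.prod_const, Finset.card_univ, Fintype.card_fin] at h
  rw [h]
  refine Finset.sum_bij (fun l _ => ⇑l) ?_ ?_ ?_ ?_
  · intro l hl
    rw [Finset.mem_finsuppAntidiag] at hl
    exact Finset.Nat.mem_antidiagonalTuple.2 hl.1
  · intro a _ b _ hab
    exact DFunLike.coe_injective hab
  · intro b hb
    refine ⟨Finsupp.equivFunOnFinite.symm b, ?_, rfl⟩
    rw [Finset.mem_finsuppAntidiag]
    exact ⟨Finset.Nat.mem_antidiagonalTuple.1 hb, by simp⟩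
  · intros
    rfl

open PowerSeries in
theorem PowerSeries.constantCoeff_rescale_exp (a : ℚ) :
    constantCoeff (rescale a (exp ℚ)) = 1 := by
  rw [← coeff_zero_eq_constantCoeff_apply, coeff_rescale]
  simp

open PowerSeries in
/-- The power series `sinh (√x / 2) / (√x / 2)`. -/
noncomputable def sinhcSeries : ℚ⟦X⟧ :=
  mk fun i => 1 / (2 ^ (2 * i) * (Nat.factorial (2 * i + 1) : ℚ))

open PowerSeries in
theorem constantCoeff_sinhcSeries : constantCoeff sinhcSeries = 1 := by
  simp [sinhcSeries, ← coeff_zero_eq_constantCoeff_apply]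

open PowerSeries in
theorem X_mul_expand_rescale_sinhcSeries (a : ℚ) :
    C (2 * a) * X * expand 2 two_ne_zero (rescale ((2 * a) ^ 2) sinhcSeries) =
      rescale a (exp ℚ) - rescale (-a) (exp ℚ) := by
  ext k
  rw [mul_assoc, coeff_C_mul]
  cases k with
  | zero => simp [constantCoeff_rescale_exp]
  | succ k =>
    rw [coeff_succ_X_mul, coeff_expand]
    simp only [map_sub, coeff_rescale, coeff_exp, sinhcSeries, coeff_mk, Algebra.algebraMap_self,
      RingHom.id_apply]
    split_ifs with h
    · obtain ⟨j, rfl⟩ := h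
      have hf : (Nat.factorial (2 * j + 1) : ℚ) ≠ 0 := by positivity
      rw [Nat.mul_div_cancel_left _ two_pos, Odd.neg_pow ⟨j, rfl⟩, ← pow_mul, mul_pow]
      field_simp
      ring
    · rw [Even.neg_pow (by rw [Nat.even_add_one, even_iff_two_dvd]; exact h)]
      ring

open PowerSeries in
theorem coeff_sinhcSeries_mul_pow_inv (n : ℕ) :
    coeff n (rescale ((2 * ((n : ℚ) + 1)) ^ 2) sinhcSeries * sinhcSeries⁻¹ ^ (2 * n + 2)) =
      1 / ((n : ℚ) + 1) := by
  set S := expand 2 two_ne_zero sinhcSeries with hS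
  set R := expand 2 two_ne_zero sinhcSeries⁻¹ with hR
  set e := rescale (1 / 2 : ℚ) (exp ℚ) with he
  set e' := rescale (-(1 / 2) : ℚ) (exp ℚ) with he'
  have hRS : R * S = 1 := by
    rw [hR, hS, ← map_mul, PowerSeries.inv_mul_cancel _ (by simp [constantCoeff_sinhcSeries]),
      map_one]
  have hS0 : constantCoeff S = 1 := by rw [hS, constantCoeff_expand, constantCoeff_sinhcSeries]
  have hR0 : constantCoeff R = 1 := by simpa [hS0] using congrArg constantCoeff hRS
  have hXS : X * S = e - e' := by
    have h := X_mul_expand_rescale_sinhcSeries (1 / 2)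
    rwa [show (2 * (1 / 2) : ℚ) = 1 by norm_num, map_one, one_mul, one_pow, rescale_one,
      RingHom.id_apply] at h
  have hde : derivative ℚ e = C (1 / 2) * e := by
    ext k
    simp [he, coeff_derivative, coeff_exp, Nat.factorial_succ]
    field_simp
    ring
  have hde' : derivative ℚ e' = - C (1 / 2) * e' := by
    ext k
    simp [he', coeff_derivative, coeff_exp, Nat.factorial_succ]
    field_simp
    ring
  have hdS : S + X * derivative ℚ S = C (1 / 2) * (e + e') := by
    have h := congrArg (derivative ℚ) hXS
    rw [Derivation.leibniz, map_sub, hde, hde', derivative_X] at h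
    simp only [smul_eq_mul] at h
    linear_combination h
  have hdR : derivative ℚ R * S + R * derivative ℚ S = 0 := by
    have h := congrArg (derivative ℚ) hRS
    rw [Derivation.leibniz] at h
    simp only [smul_eq_mul, Derivation.map_one_eq_zero] at h
    linear_combination h
  have hhalf : (C (1 / 2) : ℚ⟦X⟧) * 2 = 1 := by
    rw [show (2 : ℚ⟦X⟧) = C 2 from (map_ofNat C 2).symm, ← map_mul]; norm_num
  have hX : X = R * e - R * e' := by linear_combination R * hXS - X * hRS
  have hdR' : X * derivative ℚ R = R - C (1 / 2) * R ^ 2 * (e + e') := by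
    linear_combination (-X * derivative ℚ R + R) * hRS + X * R * hdR - R ^ 2 * hdS
  have hT := coeff_pow_succ_of_sq_eq (U := R * e) (c := 1) (by simp [hR0, he, constantCoeff_rescale_exp]) (by
    rw [Derivation.leibniz, hde]
    simp only [smul_eq_mul, map_one]
    linear_combination e * hdR' - (1 - C (1 / 2)) * (R * e) * hX
      - (R * e) * (R * e') * hhalf) (2 * n + 1)
  have hU := coeff_pow_succ_of_sq_eq (U := R * e') (c := -1) (by simp [hR0, he', constantCoeff_rescale_exp]) (by
    rw [Derivation.leibniz, hde']
    simp only [smul_eq_mul, map_neg, map_one]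
    linear_combination e' * hdR' + (1 - C (1 / 2)) * (R * e') * hX
      - (R * e) * (R * e') * hhalf) (2 * n + 1)
  have hpow : ∀ c : ℚ, rescale c (exp ℚ) ^ (2 * n + 2) =
      rescale (c * (2 * n + 2)) (exp ℚ) := by
    intro c
    rw [← map_pow, exp_pow_eq_rescale_exp, rescale_rescale]
    push_cast
    ring_nf
  have key := X_mul_expand_rescale_sinhcSeries ((n : ℚ) + 1)
  have hW : C (2 * ((n : ℚ) + 1)) * (X * expand 2 two_ne_zero
      (rescale ((2 * ((n : ℚ) + 1)) ^ 2) sinhcSeries * sinhcSeries⁻¹ ^ (2 * n + 2))) =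
      (R * e) ^ (2 * n + 2) - (R * e') ^ (2 * n + 2) := by
    rw [mul_pow R, mul_pow R, hpow, hpow, map_mul (expand 2 two_ne_zero), map_pow, ← hR,
      show (1 / 2 : ℚ) * (2 * n + 2) = n + 1 by ring,
      show -(1 / 2 : ℚ) * (2 * n + 2) = -(n + 1) by ring]
    linear_combination R ^ (2 * n + 2) * key
  have hc := congrArg (coeff (2 * n + 1)) hW
  rw [coeff_C_mul, coeff_succ_X_mul, coeff_expand_mul, map_sub, hT, hU, one_pow,
    Odd.neg_one_pow ⟨n, rfl⟩] at hc
  rw [eq_div_iff (by positivity)]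
  linear_combination hc / 2

open PowerSeries in
theorem coeff_inv_sinhcSeries_pow (N k : ℕ) (hk : 1 ≤ k) :
    coeff k (sinhcSeries⁻¹ ^ (N + 1)) =
      ∑ m ∈ Finset.Icc 1 k, (-1 : ℚ) ^ m * (Nat.choose (N + m) m : ℚ) *
        ∑ i ∈ (Finset.Nat.antidiagonalTuple m k).filter (fun i => ∀ j, 0 < i j),
          ∏ j, (1 : ℚ) / (2 ^ (2 * i j) * (Nat.factorial (2 * i j + 1) : ℚ)) := by
  have h0 : constantCoeff (sinhcSeries - 1) = 0 := by simp [constantCoeff_sinhcSeries]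
  rw [coeff_pow_succ_of_mul_one_add_eq_one (H := sinhcSeries - 1) h0 (by
      rw [add_sub_cancel, PowerSeries.inv_mul_cancel _ (by simp [constantCoeff_sinhcSeries])]),
    Finset.range_eq_Ico, Finset.sum_eq_sum_Ico_succ_bot (by omega)]
  have hk0 : coeff k (1 : ℚ⟦X⟧) = 0 := by rw [coeff_one, if_neg (by omega)]
  rw [pow_zero (sinhcSeries - 1), hk0, mul_zero, zero_add]
  refine Finset.sum_congr (by ext; simp [Nat.succ_le_iff]) fun m _ => ?_
  rw [coeff_pow_eq_sum_antidiagonalTuple, Finset.sum_filter]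
  congr 1
  refine Finset.sum_congr rfl fun i _ => ?_
  split_ifs with h
  · refine Finset.prod_congr rfl fun j _ => ?_
    rw [map_sub, coeff_one, if_neg (h j).ne', sub_zero, sinhcSeries, coeff_mk]
  · push Not at h
    obtain ⟨j, hj⟩ := h
    refine Finset.prod_eq_zero (Finset.mem_univ j) ?_
    rw [Nat.le_zero.1 hj, coeff_zero_eq_constantCoeff_apply, h0]

/-- The combinatorial identity `J_g = 1` from Step 5 of the proof of the closed formula
for Hodge integrals over meromorphic strata. -/
theorem Jg_eq_one (g : ℕ) (hg : 1 ≤ g) :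
    (g : ℚ) *
        (∑ d ∈ Finset.range (g - 1),
          (2 * (g : ℚ)) ^ (2 * d) / (2 ^ (2 * d) * (Nat.factorial (2 * d + 1) : ℚ)) *
            ∑ m ∈ Finset.Icc 1 (g - 1 - d),
              (-1 : ℚ) ^ m * (Nat.choose (2 * g - 1 + m) m : ℚ) *
                ∑ i ∈ (Finset.Nat.antidiagonalTuple m (g - 1 - d)).filter
                    (fun i => ∀ j, 0 < i j),
                  ∏ j, (1 : ℚ) / (2 ^ (2 * i j) * (Nat.factorial (2 * i j + 1) : ℚ))) +
      (g : ℚ) * (2 * (g : ℚ)) ^ (2 * g - 2) /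
        (2 ^ (2 * g - 2) * (Nat.factorial (2 * g - 1) : ℚ)) = 1 := by
  obtain ⟨n, rfl⟩ : ∃ n, g = n + 1 := ⟨g - 1, by omega⟩
  have key := coeff_sinhcSeries_mul_pow_inv n
  rw [PowerSeries.coeff_mul, Finset.Nat.sum_antidiagonal_eq_sum_range_succ_mk,
    Finset.sum_range_succ] at key
  have hcoeff : ∀ d : ℕ, PowerSeries.coeff d
      (PowerSeries.rescale ((2 * ((n : ℚ) + 1)) ^ 2) sinhcSeries) =
      (2 * ((n : ℚ) + 1)) ^ (2 * d) / (2 ^ (2 * d) * (Nat.factorial (2 * d + 1) : ℚ)) := by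
    intro d
    rw [PowerSeries.coeff_rescale, sinhcSeries, PowerSeries.coeff_mk, ← pow_mul, mul_one_div]
  simp only [hcoeff, Nat.sub_self, PowerSeries.coeff_zero_eq_constantCoeff_apply, map_pow,
    PowerSeries.constantCoeff_inv, constantCoeff_sinhcSeries, inv_one, one_pow, mul_one] at key
  rw [Finset.sum_congr rfl fun d hd => by
    rw [show 2 * n + 2 = 2 * n + 1 + 1 from rfl,
      coeff_inv_sinhcSeries_pow _ _ (by have := Finset.mem_range.1 hd; omega)]] at key
  rw [show 2 * (n + 1) - 2 = 2 * n by omega, show 2 * (n + 1) - 1 = 2 * n + 1 by omega,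
    Nat.add_sub_cancel]
  push_cast
  rw [mul_div_assoc, ← mul_add, key]
  field_simp
end

section
/- Work in the field ℚ((z)) of formal Laurent series over ℚ. Let sinh(g·z) denote the Laurent (in fact power) series Σ_{k≥0} g^{2k+1} z^{2k+1}/(2k+1)! and let sinh(z/2) denote the series Σ_{k≥0} z^{2k+1}/(2^{2k+1}·(2k+1)!). For every integer g ≥ 1, the coefficient of z^{-1} in the Laurent series sinh(g·z) · (sinh(z/2))^{-2g} equals 2^{2g}. -/
/-- The formal power series `sinh(a·z) = Σ_{k≥0} a^{2k+1} z^{2k+1}/(2k+1)!`: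
its `n`-th coefficient is `a^n/n!` for odd `n` and `0` for even `n`. -/
noncomputable def sinhScaled (a : ℚ) : PowerSeries ℚ :=
  PowerSeries.mk fun n => if Odd n then a ^ n / (Nat.factorial n : ℚ) else 0

open PowerSeries in
theorem sinhScaled_eq_exp (a : ℚ) :
    sinhScaled a = C (1 / 2) * (rescale a (exp ℚ) - rescale (-a) (exp ℚ)) := by
  ext n
  rcases Nat.even_or_odd n with h | h
  · simp [sinhScaled, coeff_rescale, coeff_exp, h.neg_pow, Nat.not_odd_iff_even.mpr h]
  · simp [sinhScaled, coeff_rescale, coeff_exp, h.neg_pow, h]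
    ring

/-- The formal power series `cosh(a·z)`. -/
noncomputable def coshScaled (a : ℚ) : PowerSeries ℚ :=
  PowerSeries.C (1 / 2) *
    (PowerSeries.rescale a (PowerSeries.exp ℚ) + PowerSeries.rescale (-a) (PowerSeries.exp ℚ))

open PowerSeries in
theorem constantCoeff_sinhScaled (a : ℚ) : constantCoeff (sinhScaled a) = 0 := by
  rw [← coeff_zero_eq_constantCoeff_apply, sinhScaled, coeff_mk]
  simp

open PowerSeries in
theorem coeff_one_sinhScaled (a : ℚ) : coeff 1 (sinhScaled a) = a := by
  simp [sinhScaled]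

open PowerSeries in
theorem constantCoeff_coshScaled (a : ℚ) : constantCoeff (coshScaled a) = 1 := by
  rw [← coeff_zero_eq_constantCoeff_apply, coshScaled, coeff_C_mul, map_add, coeff_rescale,
    coeff_rescale, coeff_exp]
  norm_num

open PowerSeries in
theorem derivative_sinhScaled (a : ℚ) :
    derivative ℚ (sinhScaled a) = C a * coshScaled a := by
  ext n
  rw [coeff_derivative]
  have hn : ((n : ℚ) + 1) ≠ 0 := by positivity
  have hf : ((n.factorial : ℕ) : ℚ) ≠ 0 := by positivity
  simp only [sinhScaled_eq_exp, coshScaled, coeff_C_mul, map_sub, map_add, coeff_rescale,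
    coeff_exp, Nat.factorial_succ, Algebra.algebraMap_self, RingHom.id_apply]
  push_cast
  field_simp
  ring

open PowerSeries in
theorem rescale_exp_add (a b : ℚ) :
    rescale (a + b) (exp ℚ) = rescale a (exp ℚ) * rescale b (exp ℚ) :=
  (exp_mul_exp_eq_exp_add a b).symm

open PowerSeries in
theorem rescale_exp_mul_neg (a : ℚ) :
    rescale a (exp ℚ) * rescale (-a) (exp ℚ) = 1 := by
  rw [← rescale_exp_add]
  simp

open PowerSeries in
theorem sinhScaled_two_mul (a : ℚ) :
    sinhScaled (2 * a) = 2 * sinhScaled a * coshScaled a := by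
  have h2 : (C (1 / 2) : PowerSeries ℚ) * 2 = 1 := by
    rw [← map_ofNat (C (R := ℚ)) 2, ← map_mul]; norm_num
  simp only [sinhScaled_eq_exp, coshScaled, two_mul a, neg_add, rescale_exp_add]
  linear_combination -C (1 / 2) * (rescale a (exp ℚ) ^ 2 - rescale (-a) (exp ℚ) ^ 2) * h2

open PowerSeries in
theorem sinhScaled_add_two_mul (a b : ℚ) :
    sinhScaled (a + 2 * b) =
      (2 + 4 * sinhScaled b ^ 2) * sinhScaled a - sinhScaled (a - 2 * b) := by
  have h2 : (C (1 / 2) : PowerSeries ℚ) * 2 = 1 := by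
    rw [← map_ofNat (C (R := ℚ)) 2, ← map_mul]; norm_num
  have hb := rescale_exp_mul_neg b
  have e1 : a + 2 * b = a + (b + b) := by ring
  have e2 : -(a + 2 * b) = -a + (-b + -b) := by ring
  have e3 : a - 2 * b = a + (-b + -b) := by ring
  have e4 : -(a - 2 * b) = -a + (b + b) := by ring
  rw [sinhScaled_eq_exp (a + 2 * b), sinhScaled_eq_exp (a - 2 * b), e2, e4, e1, e3,
    sinhScaled_eq_exp a, sinhScaled_eq_exp b]
  simp only [rescale_exp_add]
  generalize rescale a (exp ℚ) = A at *
  generalize rescale (-a) (exp ℚ) = A' at *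
  generalize rescale b (exp ℚ) = B at *
  generalize rescale (-b) (exp ℚ) = B' at *
  generalize (C (1 / 2) : PowerSeries ℚ) = c at *
  linear_combination 2 * c * (A - A') * hb -
    (2 * c + 1) * c * (B - B') ^ 2 * (A - A') * h2

open PowerSeries in
/-- If `S * W = X`, then `S' * W ^ n` has no coefficient in degree `n - 1` for `n ≥ 2`:
the residue of `S' / S ^ n` vanishes. -/
theorem coeff_derivative_mul_pow_eq_zero {S W : PowerSeries ℚ} (h : S * W = X) (n : ℕ) :
    coeff (n + 1) (derivative ℚ S * W ^ (n + 2)) = 0 := by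
  have h1 : derivative ℚ S * W + S * derivative ℚ W = 1 := by
    have := congrArg (derivative ℚ) h
    simp only [Derivation.leibniz, smul_eq_mul, derivative_X] at this
    linear_combination this
  have h2 : C ((n : ℚ) + 1) * (derivative ℚ S * W ^ (n + 2)) =
      C ((n : ℚ) + 1) * W ^ (n + 1) - X * derivative ℚ (W ^ (n + 1)) := by
    rw [Derivation.leibniz_pow]
    simp only [map_add, map_natCast, map_one, nsmul_eq_mul, smul_eq_mul, Nat.add_sub_cancel]
    push_cast
    linear_combination ((n : PowerSeries ℚ) + 1) * W ^ (n + 1) * h1 -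
      ((n : PowerSeries ℚ) + 1) * derivative ℚ W * W ^ n * h
  have h3 := congrArg (coeff (n + 1)) h2
  rw [coeff_C_mul, map_sub, coeff_C_mul, coeff_succ_X_mul, coeff_derivative] at h3
  have hn : ((n : ℚ) + 1) ≠ 0 := by positivity
  refine (mul_eq_zero.mp (h3.trans ?_)).resolve_left hn
  ring

open PowerSeries in
theorem coeff_cosh_half_mul_pow {W : PowerSeries ℚ} (h : sinhScaled (1 / 2) * W = X) (k : ℕ) :
    coeff k (coshScaled (1 / 2) * W ^ (k + 1)) = if k = 0 then 2 else 0 := by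
  have hD := derivative_sinhScaled (1 / 2)
  cases k with
  | zero =>
    have h1 := congrArg (coeff 1) h
    rw [coeff_mul, Finset.Nat.antidiagonal_succ] at h1
    simp [coeff_one_sinhScaled, constantCoeff_sinhScaled] at h1
    simp [constantCoeff_coshScaled]
    linarith
  | succ n =>
    have h1 := coeff_derivative_mul_pow_eq_zero h n
    rw [hD, mul_assoc, coeff_C_mul] at h1
    simpa using h1

open PowerSeries in
theorem coeff_sinhScaled_mul_pow {W : PowerSeries ℚ} (h : sinhScaled (1 / 2) * W = X) (g : ℕ) :
    (∀ k, coeff (2 * g + k) (sinhScaled g * W ^ (2 * g + k + 1)) = 0) ∧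
      ∀ k, coeff (2 * g + 1 + k) (sinhScaled (g + 1) * W ^ (2 * g + 2 + k)) =
        if k = 0 then 4 ^ (g + 1) else 0 := by
  induction g with
  | zero =>
    have hz : sinhScaled 0 = 0 := by simp [sinhScaled_eq_exp]
    refine ⟨fun k => by simp [hz], fun k => ?_⟩
    have h1 : sinhScaled 1 * W ^ (k + 2) =
        C 2 * (X * (coshScaled (1 / 2) * W ^ (k + 1))) := by
      have := sinhScaled_two_mul (1 / 2)
      rw [show (2 : ℚ) * (1 / 2) = 1 by norm_num] at this
      rw [this, map_ofNat]
      linear_combination 2 * coshScaled (1 / 2) * W ^ (k + 1) * h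
    have e : 2 * 0 + 2 + k = k + 2 := by ring
    have e' : 2 * 0 + 1 + k = k + 1 := by ring
    rw [e, e', Nat.cast_zero, zero_add, h1, coeff_C_mul, coeff_succ_X_mul,
      coeff_cosh_half_mul_pow h]
    split_ifs <;> norm_num
  | succ g ih =>
    obtain ⟨ih0, ih1⟩ := ih
    refine ⟨fun k => ?_, fun k => ?_⟩
    · have := ih1 (k + 1)
      rw [if_neg k.succ_ne_zero] at this
      rw [show 2 * (g + 1) + k + 1 = 2 * g + 2 + (k + 1) by ring,
        show 2 * (g + 1) + k = 2 * g + 1 + (k + 1) by ring, Nat.cast_succ, this]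
    · have hrec : sinhScaled (((g + 1 : ℕ) : ℚ) + 1) * W ^ (2 * (g + 1) + 2 + k) =
          C 2 * (sinhScaled (g + 1) * W ^ (2 * g + 2 + (k + 2))) +
          C 4 * (X ^ 2 * (sinhScaled (g + 1) * W ^ (2 * g + 2 + k))) -
          sinhScaled g * W ^ (2 * g + (k + 3) + 1) := by
        have := sinhScaled_add_two_mul ((g : ℚ) + 1) (1 / 2)
        rw [show (2 : ℚ) * (1 / 2) = 1 by norm_num, add_sub_cancel_right] at this
        push_cast
        rw [this, map_ofNat, map_ofNat, ← h]
        ring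
      rw [hrec, map_sub, map_add, coeff_C_mul, coeff_C_mul,
        show 2 * (g + 1) + 1 + k = 2 * g + 1 + k + 2 by ring, coeff_X_pow_mul, ih1 k]
      have a1 := ih1 (k + 2)
      have a2 := ih0 (k + 3)
      rw [if_neg (by omega), show 2 * g + 1 + (k + 2) = 2 * g + 1 + k + 2 by ring] at a1
      rw [show 2 * g + (k + 3) = 2 * g + 1 + k + 2 by ring] at a2 ⊢
      rw [a1, a2]
      split_ifs <;> ring

open PowerSeries in
theorem exists_sinhScaled_half_mul_eq_X : ∃ W : PowerSeries ℚ, sinhScaled (1 / 2) * W = X := by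
  obtain ⟨U, hU⟩ := X_dvd_iff.mpr (constantCoeff_sinhScaled (1 / 2))
  have hU0 : constantCoeff U ≠ 0 := by
    have hs := coeff_one_sinhScaled (1 / 2)
    rw [hU, ← zero_add 1, coeff_succ_X_mul, coeff_zero_eq_constantCoeff_apply] at hs
    rw [hs]; norm_num
  exact ⟨U⁻¹, by rw [hU, mul_assoc, PowerSeries.mul_inv_cancel U hU0, mul_one]⟩

/-- For `g ≥ 1`, the coefficient of `z^{-1}` in the formal Laurent series
`sinh(gz)·(sinh(z/2))^{-2g}` equals `2^{2g}`. -/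
theorem coeff_neg_one_sinh_ratio (g : ℕ) (hg : 1 ≤ g) :
    ((HahnSeries.ofPowerSeries ℤ ℚ (sinhScaled (g : ℚ))) *
        ((HahnSeries.ofPowerSeries ℤ ℚ (sinhScaled (1 / 2))) ^ (2 * g))⁻¹).coeff (-1)
      = 2 ^ (2 * g) := by
  obtain ⟨W, hW⟩ := exists_sinhScaled_half_mul_eq_X
  have hmul : HahnSeries.ofPowerSeries ℤ ℚ (sinhScaled (1 / 2)) ^ (2 * g) *
      (HahnSeries.ofPowerSeries ℤ ℚ (W ^ (2 * g)) *
        HahnSeries.single (-((2 * g : ℕ) : ℤ)) 1) = 1 := by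
    rw [← mul_assoc, ← map_pow, ← map_mul, ← mul_pow, hW, HahnSeries.ofPowerSeries_X_pow,
      HahnSeries.single_mul_single]
    simp
  have hdeg : (-1 : ℤ) = ((2 * g - 1 : ℕ) : ℤ) + -((2 * g : ℕ) : ℤ) := by omega
  rw [inv_eq_of_mul_eq_one_right hmul, ← mul_assoc, ← map_mul, hdeg,
    HahnSeries.coeff_mul_single_add, mul_one, HahnSeries.ofPowerSeries_apply_coeff]
  obtain ⟨m, rfl⟩ := Nat.exists_eq_add_of_le' hg
  have := (coeff_sinhScaled_mul_pow hW m).2 0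
  rw [if_pos rfl] at this
  rw [show 2 * (m + 1) - 1 = 2 * m + 1 + 0 by omega, Nat.cast_succ]
  refine this.trans ?_
  rw [pow_mul]
  norm_num
end

section
/- Work in the field ℚ((x)) of formal Laurent series over ℚ. Let cosh(x) = Σ_{k≥0} x^{2k}/(2k)! and sinh(x) = Σ_{k≥0} x^{2k+1}/(2k+1)!, and define coth(x) = cosh(x)·sinh(x)^{-1} ∈ ℚ((x)). Then for every integer k ≥ 0, the coefficient of x^{-1} in coth(x)^{2k+1} equals 1. -/
/-- The formal power series `cosh(x) = Σ_{k≥0} x^{2k}/(2k)!`. -/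
noncomputable def coshPS : PowerSeries ℚ :=
  PowerSeries.mk fun n => if Even n then 1 / (Nat.factorial n : ℚ) else 0

/-- The formal power series `sinh(x) = Σ_{k≥0} x^{2k+1}/(2k+1)!`. -/
noncomputable def sinhPS : PowerSeries ℚ :=
  PowerSeries.mk fun n => if Odd n then 1 / (Nat.factorial n : ℚ) else 0

/-- The formal Laurent series `coth(x) = cosh(x)·sinh(x)⁻¹ ∈ ℚ((x))`. -/
noncomputable def cothL : LaurentSeries ℚ :=
  (HahnSeries.ofPowerSeries ℤ ℚ coshPS) * (HahnSeries.ofPowerSeries ℤ ℚ sinhPS)⁻¹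

open PowerSeries in
theorem derivative_coshPS : derivative ℚ coshPS = sinhPS := by
  ext n
  have hn : (n : ℚ) + 1 ≠ 0 := by positivity
  have hf : (n.factorial : ℚ) ≠ 0 := by positivity
  simp only [coeff_derivative, coshPS, sinhPS, coeff_mk, Nat.even_add_one, Nat.not_even_iff_odd]
  split_ifs
  · push_cast [Nat.factorial_succ]
    field_simp
  · simp

open PowerSeries in
theorem derivative_sinhPS : derivative ℚ sinhPS = coshPS := by
  ext n
  have hn : (n : ℚ) + 1 ≠ 0 := by positivity
  have hf : (n.factorial : ℚ) ≠ 0 := by positivity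
  simp only [coeff_derivative, coshPS, sinhPS, coeff_mk, Nat.odd_add_one, Nat.not_odd_iff_even]
  split_ifs
  · push_cast [Nat.factorial_succ]
    field_simp
  · simp

open PowerSeries in
/-- The equation satisfied by `g = x·coth(x)`, a form of `coth' = 1 - coth²`, makes the diagonal
coefficients `[x^n] g^{n+1}` periodic in `n` with period `2`. -/
theorem coeff_pow_add_two {g : PowerSeries ℚ} (hg : X * derivative ℚ g = X ^ 2 + g - g ^ 2)
    (n : ℕ) : coeff (n + 2) (g ^ (n + 3)) = coeff n (g ^ (n + 1)) := by
  have hpow : ((n : ℚ) + 2) • g ^ (n + 3) =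
      ((n : ℚ) + 2) • (X ^ 2 * g ^ (n + 1) + g ^ (n + 2)) - X * derivative ℚ (g ^ (n + 2)) := by
    rw [Derivation.leibniz_pow]
    simp only [smul_eq_C_mul, nsmul_eq_mul, smul_eq_mul, map_add, map_natCast, map_ofNat]
    push_cast
    linear_combination (n + 2 : PowerSeries ℚ) * g ^ (n + 1) * hg
  have hcoeff := congrArg (coeff (n + 2)) hpow
  rw [map_sub, coeff_smul, coeff_smul, map_add, coeff_succ_X_mul, coeff_derivative,
    coeff_X_pow_mul] at hcoeff
  have hn : (n : ℚ) + 2 ≠ 0 := by positivity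
  apply mul_left_cancel₀ hn
  push_cast at hcoeff
  simp only [smul_eq_mul] at hcoeff
  linear_combination hcoeff

open PowerSeries in
/-- `coth(x) = x⁻¹·g` for a power series `g = x·coth(x)` with constant term `1` satisfying the
equation of `coeff_pow_add_two`. -/
theorem exists_cothL_eq_single_mul : ∃ g : PowerSeries ℚ,
    constantCoeff g = 1 ∧ X * derivative ℚ g = X ^ 2 + g - g ^ 2 ∧
      cothL = HahnSeries.single (-1) 1 * HahnSeries.ofPowerSeries ℤ ℚ g := by
  obtain ⟨s, hs⟩ : X ∣ sinhPS := X_dvd_iff.2 (by simp [sinhPS])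
  have hcs : coshPS = s + X * derivative ℚ s := by
    rw [← derivative_sinhPS, hs, Derivation.leibniz, derivative_X]
    simp only [smul_eq_mul]
    ring
  have hc0 : constantCoeff coshPS = 1 := by simp [coshPS]
  have hs0 : constantCoeff s = 1 := by simpa [hcs] using hc0
  have hs_ne : constantCoeff s ≠ 0 := by simp [hs0]
  have hs_ne_zero : s ≠ 0 := by
    rintro rfl
    simp at hs0
  have hgs : coshPS * s⁻¹ * s = coshPS := by
    rw [mul_assoc, PowerSeries.inv_mul_cancel s hs_ne, mul_one]
  refine ⟨coshPS * s⁻¹, by simp [hc0, hs0], ?_, ?_⟩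
  · generalize coshPS * s⁻¹ = g at hgs
    have hd := congrArg (derivative ℚ) hgs
    rw [derivative_coshPS, hs, Derivation.leibniz] at hd
    simp only [smul_eq_mul] at hd
    apply mul_left_cancel₀ hs_ne_zero
    linear_combination X * hd + g * hcs + g * hgs
  · have hinj : HahnSeries.ofPowerSeries ℤ ℚ s ≠ 0 := by
      rwa [Ne, map_eq_zero_iff _ HahnSeries.ofPowerSeries_injective]
    have hX : (HahnSeries.single (-1) 1 : LaurentSeries ℚ) * HahnSeries.single 1 1 = 1 := by
      simp
    have hX_ne := right_ne_zero_of_mul_eq_one hX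
    rw [cothL, hs, map_mul, HahnSeries.ofPowerSeries_X, ← div_eq_mul_inv,
      div_eq_iff (mul_ne_zero hX_ne hinj)]
    conv_lhs => rw [← hgs, map_mul]
    linear_combination -HahnSeries.ofPowerSeries ℤ ℚ (coshPS * s⁻¹) *
      HahnSeries.ofPowerSeries ℤ ℚ s * hX

/-- For every `k ≥ 0`, the coefficient of `x^{-1}` in `coth(x)^{2k+1}` equals `1`. -/
theorem coeff_neg_one_coth_odd_pow (k : ℕ) :
    (cothL ^ (2 * k + 1)).coeff (-1) = 1 := by
  obtain ⟨g, hg0, hg, hcoth⟩ := exists_cothL_eq_single_mul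
  have hdiag : PowerSeries.coeff (2 * k) (g ^ (2 * k + 1)) = 1 := by
    induction k with
    | zero => simpa using hg0
    | succ k ih => exact (coeff_pow_add_two hg (2 * k)).trans ih
  rw [hcoth, mul_pow, HahnSeries.single_pow, one_pow, ← map_pow]
  have hexp : (-1 : ℤ) - (2 * k + 1) • (-1 : ℤ) = ((2 * k : ℕ) : ℤ) := by
    simp
  rw [HahnSeries.coeff_single_mul, one_mul, hexp, HahnSeries.ofPowerSeries_apply_coeff, hdiag]
end

section
/- For every integer k ≥ 0, the following identity of rational numbers holds: Σ_{(n_1,…,n_{2k+1}) ∈ ℤ_{≥0}^{2k+1}, n_1+⋯+n_{2k+1} = k} ∏_{j=1}^{2k+1} B_{2n_j}/(2n_j)! = 1/2^{2k}, where B_m denotes the m-th Bernoulli number. Equivalently, Σ_{n_1+⋯+n_{2k+1}=k} multinomial(2k; 2n_1,…,2n_{2k+1}) · B_{2n_1}⋯B_{2n_{2k+1}} = (2k)!/2^{2k}. -/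
open PowerSeries in
theorem sum_antidiagonalTuple_prod_eq_coeff_pow {R : Type*} [CommSemiring R] (a : ℕ → R)
    (m d : ℕ) :
    ∑ n ∈ Finset.Nat.antidiagonalTuple m d, ∏ j, a (n j) = coeff d (mk a ^ m) := by
  have h : mk a ^ m = ∏ _j : Fin m, mk a := by simp
  rw [h, coeff_prod]
  refine Finset.sum_bij' (fun n _ => Finsupp.equivFunOnFinite.symm n) (fun l _ => ⇑l)
    ?_ ?_ ?_ ?_ ?_
  · intro n hn
    simpa [Finset.mem_finsuppAntidiag, Finset.Nat.mem_antidiagonalTuple] using hn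
  · intro l hl
    simpa [Finset.mem_finsuppAntidiag, Finset.Nat.mem_antidiagonalTuple] using hl
  · intro n _
    rfl
  · intro l _
    ext
    rfl
  · intro n _
    simp

open PowerSeries in
/-- The generating function `(X / 2) * coth (X / 2)` of the even-index Bernoulli numbers. -/
theorem expand_two_mk_bernoulli :
    expand 2 two_ne_zero (mk fun n => bernoulli (2 * n) / (Nat.factorial (2 * n) : ℚ)) =
      bernoulliPowerSeries ℚ + C (1 / 2) * X := by
  ext n
  rw [coeff_expand, map_add, coeff_C_mul, coeff_X, bernoulliPowerSeries]
  rcases Nat.even_or_odd n with he | ho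
  · have h1 : n ≠ 1 := by rintro rfl; simp at he
    rw [if_pos he.two_dvd, coeff_mk, coeff_mk, Nat.mul_div_cancel' he.two_dvd]
    simp [h1]
  · rw [if_neg (by simpa [← even_iff_two_dvd] using ho)]
    by_cases h1 : n = 1
    · subst h1
      norm_num
    · rw [coeff_mk, bernoulli_eq_zero_of_odd ho (by have := ho.pos; omega)]
      simp [h1]

open PowerSeries in
/-- The Riccati equation satisfied by the exponential generating function `X / (exp X - 1)`. -/
theorem X_mul_derivative_bernoulliPowerSeries :
    X * d⁄dX ℚ (bernoulliPowerSeries ℚ) =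
      bernoulliPowerSeries ℚ - bernoulliPowerSeries ℚ ^ 2 - X * bernoulliPowerSeries ℚ := by
  have h := bernoulliPowerSeries_mul_exp_sub_one ℚ
  have hne : exp ℚ - 1 ≠ 0 := fun h0 => X_ne_zero (R := ℚ) (by rw [← h, h0, mul_zero])
  have hd := congrArg (d⁄dX ℚ) h
  rw [Derivation.leibniz, map_sub, derivative_exp, derivative_one, derivative_X, sub_zero,
    smul_eq_mul, smul_eq_mul] at hd
  refine mul_right_cancel₀ hne ?_
  linear_combination X * hd + (bernoulliPowerSeries ℚ - 1) * h

open PowerSeries in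
theorem X_mul_derivative_bernoulliPowerSeries_add :
    X * d⁄dX ℚ (bernoulliPowerSeries ℚ + C (1 / 2) * X) =
      (bernoulliPowerSeries ℚ + C (1 / 2) * X) - (bernoulliPowerSeries ℚ + C (1 / 2) * X) ^ 2 +
        C (1 / 4) * X ^ 2 := by
  have h2 : (C (1 / 2 : ℚ) + C (1 / 2) : ℚ⟦X⟧) = 1 := by rw [← map_add]; norm_num
  have h4 : (C (1 / 4 : ℚ) : ℚ⟦X⟧) = C (1 / 2) ^ 2 := by rw [← map_pow]; norm_num
  rw [map_add, Derivation.leibniz, derivative_X, derivative_C, h4]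
  simp only [smul_eq_mul]
  linear_combination X_mul_derivative_bernoulliPowerSeries +
    X * bernoulliPowerSeries ℚ * h2

open PowerSeries in
/-- A coefficient recurrence for powers of a solution of `X F' = F - F ^ 2 + c X ^ 2`. -/
theorem coeff_pow_add_three_of_riccati {F : ℚ⟦X⟧} {c : ℚ}
    (hF : X * d⁄dX ℚ F = F - F ^ 2 + C c * X ^ 2) (m : ℕ) :
    coeff (m + 2) (F ^ (m + 3)) = c * coeff m (F ^ (m + 1)) := by
  have h : X * d⁄dX ℚ (F ^ (m + 2)) = C ((m + 2 : ℕ) : ℚ) *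
      (F ^ (m + 2) - F ^ (m + 3) + C c * (F ^ (m + 1) * X ^ 2)) := by
    rw [derivative_pow, map_natCast, show m + 2 - 1 = m + 1 from rfl]
    linear_combination ((m + 2 : ℕ) : ℚ⟦X⟧) * F ^ (m + 1) * hF
  have hc := congrArg (coeff (m + 2)) h
  rw [show m + 2 = (m + 1) + 1 from rfl, coeff_succ_X_mul, coeff_derivative, coeff_C_mul, map_add,
    map_sub, coeff_C_mul, show m + 1 + 1 = m + 2 from rfl, coeff_mul_X_pow] at hc
  have hm : ((m : ℚ) + 2) ≠ 0 := by positivity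
  refine mul_left_cancel₀ hm ?_
  push_cast at hc
  linear_combination hc

/-- The Bernoulli number identity: for every `k ≥ 0`,
`Σ_{n_1+⋯+n_{2k+1}=k} ∏_j B_{2n_j}/(2n_j)! = 1/2^{2k}`. -/
theorem bernoulli_tuple_sum (k : ℕ) :
    ∑ n ∈ Finset.Nat.antidiagonalTuple (2 * k + 1) k,
      ∏ j, bernoulli (2 * n j) / (Nat.factorial (2 * n j) : ℚ) = 1 / 2 ^ (2 * k) := by
  rw [sum_antidiagonalTuple_prod_eq_coeff_pow
      (fun n => bernoulli (2 * n) / (Nat.factorial (2 * n) : ℚ)),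
    ← PowerSeries.coeff_expand_mul 2 two_ne_zero, map_pow, expand_two_mk_bernoulli]
  induction k with
  | zero => simp [bernoulliPowerSeries]
  | succ k ih =>
    rw [show 2 * (k + 1) = 2 * k + 2 by ring,
      coeff_pow_add_three_of_riccati X_mul_derivative_bernoulliPowerSeries_add, ih]
    ring
end
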